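/- arXiv:1511.00152 — 4 statements merged into one kernel-verified Lean document; each statement's English description precedes it below -/
import Mathlib

section
/- Let X ∈ ℝ^{p×n} be a matrix whose columns all have unit Euclidean norm, let η > 0, let H ∈ ℝ^{p×p} be a fixed matrix all of whose entries satisfy |H_{j,l}| ≤ 1/√(ηp), let D = diag(ε) with ε ∈ {−1,+1}^p having i.i.d. uniform random sign entries, and set Y = H D X. Then for every α ∈ (0,1): P( ‖Y‖_max ≥ (1/√p)·√((2/η)·log(2np/α)) ) ≤ α. -/
open Matrix Finset

/-- Probability of event `A` under the uniform distribution on the finite type `Ω`. -/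
noncomputable def probOf {Ω : Type*} [Fintype Ω] (A : Set Ω) : ℝ :=
  (A.ncard : ℝ) / Fintype.card Ω

/-- Expectation of `f` under the uniform distribution on the finite type `Ω`. -/
noncomputable def expec {Ω E : Type*} [Fintype Ω] [AddCommMonoid E] [Module ℝ E]
    (f : Ω → E) : E :=
  (Fintype.card Ω : ℝ)⁻¹ • ∑ ω, f ω

/-- Euclidean norm of a vector. -/
noncomputable def l2norm {ι : Type*} [Fintype ι] (v : ι → ℝ) : ℝ :=
  Real.sqrt (∑ i, v i ^ 2)

/-- Random sign vector `ε ∈ {±1}^p` built from boolean coin flips. -/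
def signVec {p : ℕ} (ω : Fin p → Bool) : Fin p → ℝ := fun i => if ω i then 1 else -1

/-- The diagonal random sign matrix `D = diag(ε)`. -/
noncomputable def signMatrix {p : ℕ} (ω : Fin p → Bool) : Matrix (Fin p) (Fin p) ℝ :=
  Matrix.diagonal (signVec ω)

/-- Sampling matrix `R ∈ ℝ^{p×m}` whose `j`-th column is the canonical basis vector `e_{σ j}`;
a uniformly random `σ : Fin m ↪ Fin p` models choosing `m` distinct canonical basis vectors
uniformly at random without replacement. -/
noncomputable def sampMatrix {p m : ℕ} (σ : Fin m ↪ Fin p) : Matrix (Fin p) (Fin m) ℝ :=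
  Matrix.of fun i j => if σ j = i then 1 else 0

/-- Spectral norm (ℓ²→ℓ² operator norm) of a square matrix. -/
noncomputable def specNorm {p : ℕ} (A : Matrix (Fin p) (Fin p) ℝ) : ℝ :=
  ‖LinearMap.toContinuousLinearMap (Matrix.toEuclideanLin A)‖

/-- `diag(A)`: the matrix obtained by zeroing all off-diagonal entries of `A`. -/
noncomputable def diagPart {p : ℕ} (A : Matrix (Fin p) (Fin p) ℝ) : Matrix (Fin p) (Fin p) ℝ :=
  Matrix.diagonal A.diag

/-- Moment generating function bound for a Rademacher sum. -/
theorem mgf_sign_bound {p : ℕ} (a : Fin p → ℝ) :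
    ∑ ω : Fin p → Bool, Real.exp (∑ l, a l * signVec ω l)
      ≤ 2 ^ p * Real.exp ((∑ l, a l ^ 2) / 2) := by
  have h1 : ∀ ω : Fin p → Bool, Real.exp (∑ l, a l * signVec ω l)
      = ∏ l, (fun (l : Fin p) (b : Bool) => Real.exp (a l * (if b then 1 else -1))) l (ω l) := by
    intro ω
    rw [Real.exp_sum]
    rfl
  have h2 := (Finset.prod_univ_sum (fun _ : Fin p => (Finset.univ : Finset Bool))
    (fun (l : Fin p) (b : Bool) => Real.exp (a l * (if b then 1 else -1))))
  rw [Fintype.piFinset_univ] at h2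
  rw [Finset.sum_congr rfl (fun ω _ => h1 ω), ← h2]
  calc _ ≤ ∏ l : Fin p, (2 * Real.exp (a l ^ 2 / 2)) := by
        apply Finset.prod_le_prod
        · intro l _
          positivity
        · intro l _
          have := Real.cosh_le_exp_half_sq (a l)
          rw [Real.cosh_eq] at this
          simp only [Fintype.sum_bool, if_true, mul_one]
          simp
          linarith
    _ = _ := by
        rw [Finset.prod_mul_distrib, ← Real.exp_sum, Finset.sum_div]
        simp

theorem sum_swap3 {α β γ : Type*} [Fintype α] [Fintype β] [Fintype γ] (f : α → β → γ → ℝ) :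
    ∑ a, ∑ b, ∑ c, f a b c = ∑ b, ∑ c, ∑ a, f a b c := by
  rw [Finset.sum_comm]
  exact Finset.sum_congr rfl fun j _ => Finset.sum_comm

theorem union_markov {Ω J I : Type*} [Fintype Ω] [Fintype J] [Fintype I] (A : Set Ω)
    (f : Ω → J → I → ℝ) (hf : ∀ ω j i, 0 ≤ f ω j i) (c B : ℝ)
    (hpt : ∀ ω ∈ A, c ≤ ∑ j, ∑ i, f ω j i) (hm : ∀ j i, ∑ ω, f ω j i ≤ B) :
    (A.ncard : ℝ) * c ≤ Fintype.card J * (Fintype.card I * B) := by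
  classical
  calc (A.ncard : ℝ) * c = ∑ ω ∈ A.toFinset, c := by
        rw [Finset.sum_const, nsmul_eq_mul, Set.ncard_eq_toFinset_card']
    _ ≤ ∑ ω ∈ A.toFinset, ∑ j, ∑ i, f ω j i :=
        Finset.sum_le_sum fun ω hω => hpt ω (by simpa using hω)
    _ ≤ ∑ ω, ∑ j, ∑ i, f ω j i :=
        Finset.sum_le_sum_of_subset_of_nonneg (Finset.subset_univ _)
          (fun ω _ _ => Finset.sum_nonneg fun j _ => Finset.sum_nonneg fun i _ => hf ω j i)
    _ = ∑ j, ∑ i, ∑ ω, f ω j i := sum_swap3 f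
    _ ≤ ∑ j : J, ∑ i : I, B :=
        Finset.sum_le_sum fun j _ => Finset.sum_le_sum fun i _ => hm j i
    _ = _ := by simp

theorem entry_eq {p n : ℕ} (H : Matrix (Fin p) (Fin p) ℝ) (X : Matrix (Fin p) (Fin n) ℝ)
    (ω : Fin p → Bool) (j : Fin p) (i : Fin n) :
    (H * signMatrix ω * X) j i = ∑ l, (H j l * X l i) * signVec ω l := by
  rw [Matrix.mul_apply]
  apply Finset.sum_congr rfl
  intro l _
  rw [signMatrix, Matrix.mul_diagonal]
  ring

/-- for `Y = H D X` with unit-norm columns of `X`,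
`P(‖Y‖_max ≥ (1/√p)·√((2/η)·log(2np/α))) ≤ α`. -/
theorem stmt_1 (p n : ℕ) (hp : 0 < p) (hn : 0 < n)
    (X : Matrix (Fin p) (Fin n) ℝ) (hX : ∀ i, l2norm (fun l => X l i) = 1)
    (η : ℝ) (hη : 0 < η)
    (H : Matrix (Fin p) (Fin p) ℝ)
    (hH : ∀ j l, |H j l| ≤ 1 / Real.sqrt (η * p))
    (α : ℝ) (hα0 : 0 < α) (hα1 : α < 1) :
    probOf {ω : Fin p → Bool |
        (1 / Real.sqrt p) * Real.sqrt ((2 / η) * Real.log (2 * n * p / α)) ≤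
          ⨆ j, ⨆ i, |(H * signMatrix ω * X) j i|} ≤ α := by
  have hp' : (0:ℝ) < p := by exact_mod_cast hp
  have hn' : (1:ℝ) ≤ n := by exact_mod_cast hn
  have hp1 : (1:ℝ) ≤ p := by exact_mod_cast hp
  have : Nonempty (Fin p) := ⟨⟨0, hp⟩⟩
  have : Nonempty (Fin n) := ⟨⟨0, hn⟩⟩
  set L := Real.log (2 * n * p / α) with hL
  have hq : 0 < 2 * n * p / α := by positivity
  have hL0 : 0 ≤ L := by
    apply Real.log_nonneg
    rw [le_div_iff₀ hα0]
    nlinarith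
  set t := (1 / Real.sqrt p) * Real.sqrt ((2 / η) * L) with ht
  have ht0 : 0 ≤ t := by positivity
  have htsq : t ^ 2 * (η * p) = 2 * L := by
    rw [ht, mul_pow, div_pow, Real.sq_sqrt hp'.le, Real.sq_sqrt (by positivity)]
    field_simp
  set lam := t * (η * p) with hlam
  have hlam0 : 0 ≤ lam := by positivity
  -- variance bound
  have hvar : ∀ j i, ∑ l, (H j l * X l i) ^ 2 ≤ 1 / (η * p) := by
    intro j i
    have hx : ∑ l, X l i ^ 2 = 1 := by
      have := hX i
      rwa [l2norm, Real.sqrt_eq_one] at this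
    calc ∑ l, (H j l * X l i) ^ 2 ≤ ∑ l, 1 / (η * p) * X l i ^ 2 := by
          apply Finset.sum_le_sum
          intro l _
          rw [mul_pow]
          apply mul_le_mul_of_nonneg_right _ (sq_nonneg _)
          have := pow_le_pow_left₀ (abs_nonneg _) (hH j l) 2
          rwa [sq_abs, div_pow, Real.sq_sqrt (by positivity), one_pow] at this
      _ = _ := by rw [← Finset.mul_sum, hx, mul_one]
  -- moment bound, for either sign
  have hm : ∀ c : ℝ, c ^ 2 = lam ^ 2 → ∀ j i,
      ∑ ω : Fin p → Bool, Real.exp (c * (H * signMatrix ω * X) j i) ≤ 2 ^ p * Real.exp L := by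
    intro c hc j i
    have h := mgf_sign_bound (fun l => c * (H j l * X l i))
    have e : ∀ ω : Fin p → Bool, c * (H * signMatrix ω * X) j i
        = ∑ l, c * (H j l * X l i) * signVec ω l := by
      intro ω
      rw [entry_eq, Finset.mul_sum]
      exact Finset.sum_congr rfl fun l _ => by ring
    simp only [e]
    refine h.trans ?_
    gcongr
    simp only [mul_pow c]
    rw [← Finset.mul_sum, hc]
    have h3 := mul_le_mul_of_nonneg_left (hvar j i) (sq_nonneg lam)
    have h4 : lam ^ 2 * (1 / (η * p)) = 2 * L := by
      rw [← htsq, hlam]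
      field_simp
    linarith
  set A : Set (Fin p → Bool) := {ω | t ≤ ⨆ j, ⨆ i, |(H * signMatrix ω * X) j i|} with hA
  have hpt : ∀ ω ∈ A, Real.exp (2 * L) ≤
      ∑ j, ∑ i, (Real.exp (lam * (H * signMatrix ω * X) j i)
        + Real.exp (-lam * (H * signMatrix ω * X) j i)) := by
    intro ω hω
    have hω' : t ≤ ⨆ j, ⨆ i, |(H * signMatrix ω * X) j i| := hω
    obtain ⟨j, hj⟩ := exists_eq_ciSup_of_finite (f := fun j => ⨆ i, |(H * signMatrix ω * X) j i|)
    obtain ⟨i, hi⟩ := exists_eq_ciSup_of_finite (f := fun i => |(H * signMatrix ω * X) j i|)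
    rw [← hj] at hω'
    rw [← hi] at hω'
    have h2 : 2 * L = lam * t := by rw [← htsq, hlam]; ring
    have h3 : Real.exp (2 * L) ≤ Real.exp (lam * (H * signMatrix ω * X) j i)
        + Real.exp (-lam * (H * signMatrix ω * X) j i) := by
      rw [h2]
      rcases le_abs.mp hω' with h | h
      · have := Real.exp_le_exp.mpr (mul_le_mul_of_nonneg_left h hlam0)
        have := Real.exp_pos (-lam * (H * signMatrix ω * X) j i)
        linarith
      · have h5 := Real.exp_le_exp.mpr (mul_le_mul_of_nonneg_left h hlam0)
        rw [mul_neg, ← neg_mul] at h5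
        have := Real.exp_pos (lam * (H * signMatrix ω * X) j i)
        linarith
    refine h3.trans ?_
    refine le_trans ?_ (Finset.single_le_sum (f := fun j => ∑ i,
      (Real.exp (lam * (H * signMatrix ω * X) j i)
        + Real.exp (-lam * (H * signMatrix ω * X) j i)))
      (fun j _ => by positivity) (Finset.mem_univ j))
    exact Finset.single_le_sum (f := fun i =>
      (Real.exp (lam * (H * signMatrix ω * X) j i)
        + Real.exp (-lam * (H * signMatrix ω * X) j i)))
      (fun j _ => by positivity) (Finset.mem_univ i)
  have hcard : (A.ncard : ℝ) * Real.exp (2 * L) ≤ p * (n * (2 * (2 ^ p * Real.exp L))) := by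
    have h := union_markov A (fun ω j i => Real.exp (lam * (H * signMatrix ω * X) j i)
            + Real.exp (-lam * (H * signMatrix ω * X) j i)) (fun _ _ _ => by positivity)
            (Real.exp (2 * L)) (2 * (2 ^ p * Real.exp L)) hpt (by
          intro j i
          rw [Finset.sum_add_distrib]
          have := hm lam rfl j i
          have := hm (-lam) (by ring) j i
          linarith)
    simpa only [Fintype.card_fin] using h
  have hexp : Real.exp L = 2 * n * p / α := Real.exp_log hq
  rw [two_mul L, Real.exp_add, hexp] at hcard
  have hfin : (A.ncard : ℝ) ≤ α * 2 ^ p := by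
    have e1 : (p:ℝ) * (n * (2 * (2 ^ p * (2 * n * p / α))))
        = (α * 2 ^ p) * (2 * n * p / α * (2 * n * p / α)) := by
      field_simp
    rw [e1] at hcard
    exact le_of_mul_le_mul_right hcard (by positivity)
  rw [probOf]
  have hc : (Fintype.card (Fin p → Bool) : ℝ) = 2 ^ p := by simp
  rw [hc, div_le_iff₀ (by positivity)]
  exact hfin
end

section
/- Let x ∈ ℝ^p, let η > 0, let H ∈ ℝ^{p×p} be a fixed matrix all of whose entries satisfy |H_{j,l}| ≤ 1/√(ηp), let D = diag(ε) with ε ∈ {−1,+1}^p having i.i.d. uniform random sign entries, and set y = H D x. Let w ∈ ℝ^p be obtained from y by keeping m of its p entries, chosen as a uniformly random m-element subset of the coordinates (independent of D), and setting the rest to zero. Then for every α ∈ (0,1), with probability at least 1 − α: ‖w‖₂² ≤ (m/p)·(2/η)·log(2p/α)·‖x‖₂². -/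
open Matrix Finset

lemma mgf_aux {p : ℕ} (a : Fin p → ℝ) :
    ∑ ω : Fin p → Bool, Real.exp (∑ i, a i * signVec ω i) ≤
      2 ^ p * Real.exp ((∑ i, a i ^ 2) / 2) := by
  have h1 : ∑ ω : Fin p → Bool, Real.exp (∑ i, a i * signVec ω i) =
      ∏ i, ∑ b : Bool, Real.exp (a i * (if b then 1 else -1)) := by
    rw [Finset.prod_univ_sum]
    simp only [Fintype.piFinset_univ, Real.exp_sum, signVec]
  rw [h1, Finset.sum_div, Real.exp_sum]
  have h2 : (2 : ℝ) ^ p = ∏ _i : Fin p, (2 : ℝ) := by simp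
  rw [h2, ← Finset.prod_mul_distrib]
  apply Finset.prod_le_prod
  · intro i _
    positivity
  · intro i _
    have := Real.cosh_le_exp_half_sq (a i)
    rw [Real.cosh_eq] at this
    simp
    linarith

lemma tail_aux {p : ℕ} (a : Fin p → ℝ) (v L : ℝ) (hL : 0 ≤ L) (ha : ∑ i, a i ^ 2 ≤ v) :
    (((Finset.univ : Finset (Fin p → Bool)).filter
      (fun ω => 2 * v * L < (∑ i, a i * signVec ω i) ^ 2)).card : ℝ) ≤
      2 ^ p * (2 * Real.exp (-L)) := by
  have hv0 : 0 ≤ v := le_trans (Finset.sum_nonneg fun i _ => sq_nonneg _) ha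
  rcases hv0.eq_or_lt with hv | hv
  · have hz : ∀ i, a i = 0 := by
      intro i
      have := Finset.single_le_sum (f := fun i => a i ^ 2) (fun i _ => sq_nonneg _)
        (Finset.mem_univ i)
      have h3 : a i ^ 2 ≤ 0 := by linarith
      exact pow_eq_zero_iff (two_ne_zero) |>.1 (le_antisymm h3 (sq_nonneg _))
    rw [Finset.filter_false_of_mem]
    · simp; positivity
    · intro ω _
      simp [hz, ← hv]
  · set t := Real.sqrt (2 * L / v) with ht
    have ht2 : t ^ 2 = 2 * L / v := Real.sq_sqrt (by positivity)
    have ht0 : 0 ≤ t := Real.sqrt_nonneg _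
    have hA := mgf_aux (fun i => t * a i)
    have hB := mgf_aux (fun i => (-t) * a i)
    have e1 : ∑ i, (t * a i) ^ 2 = t ^ 2 * ∑ i, a i ^ 2 := by
      rw [Finset.mul_sum]; exact Finset.sum_congr rfl fun i _ => by ring
    have e2 : ∑ i, (-t * a i) ^ 2 = t ^ 2 * ∑ i, a i ^ 2 := by
      rw [Finset.mul_sum]; exact Finset.sum_congr rfl fun i _ => by ring
    have e3 : (t ^ 2 * ∑ i, a i ^ 2) / 2 ≤ L := by
      have : t ^ 2 * ∑ i, a i ^ 2 ≤ t ^ 2 * v := by gcongr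
      have h4 : t ^ 2 * v = 2 * L := by rw [ht2]; field_simp
      linarith
    have e4 := mul_le_mul_of_nonneg_left (Real.exp_le_exp.2 e3) (by positivity : (0:ℝ) ≤ 2 ^ p)
    simp only [e1] at hA
    simp only [e2] at hB
    have hlow : (((Finset.univ : Finset (Fin p → Bool)).filter
      (fun ω => 2 * v * L < (∑ i, a i * signVec ω i) ^ 2)).card : ℝ) * Real.exp (2 * L) ≤
        ∑ ω : Fin p → Bool, (Real.exp (∑ i, t * a i * signVec ω i) +
          Real.exp (∑ i, -t * a i * signVec ω i)) := by
      rw [← nsmul_eq_mul, ← Finset.sum_const]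
      refine le_trans (Finset.sum_le_sum ?_) (Finset.sum_le_sum_of_subset_of_nonneg
        (Finset.filter_subset _ _) fun _ _ _ => by positivity)
      intro ω hω
      rw [Finset.mem_filter] at hω
      have f1 : ∑ i, t * a i * signVec ω i = t * ∑ i, a i * signVec ω i := by
        rw [Finset.mul_sum]; exact Finset.sum_congr rfl fun i _ => by ring
      have f2 : ∑ i, -t * a i * signVec ω i = -(t * ∑ i, a i * signVec ω i) := by
        rw [Finset.mul_sum, ← Finset.sum_neg_distrib]
        exact Finset.sum_congr rfl fun i _ => by ring
      rw [f1, f2]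
      set y := ∑ i, a i * signVec ω i
      have g : 2 * L ≤ |t * y| := by
        apply le_abs.2
        apply le_abs.1
        apply (sq_le_sq₀ (by positivity) (abs_nonneg _)).1
        rw [sq_abs, mul_pow t, ht2]
        have : (2 * L) ^ 2 = 2 * L / v * (2 * v * L) := by field_simp
        rw [this]
        exact mul_le_mul_of_nonneg_left hω.2.le (by positivity)
      rcases le_abs.1 g with g | g
      · have := Real.exp_le_exp.2 g
        have := Real.exp_pos (-(t * y))
        linarith
      · have := Real.exp_le_exp.2 g
        have := Real.exp_pos (t * y)
        linarith
    rw [Finset.sum_add_distrib] at hlow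
    have hexp : Real.exp (2 * L) * Real.exp (-L) = Real.exp L := by
      rw [← Real.exp_add]; congr 1; ring
    have : (2 : ℝ) ^ p * (2 * Real.exp (-L)) * Real.exp (2 * L) = 2 * (2 ^ p * Real.exp L) := by
      rw [← hexp]; ring
    refine le_of_mul_le_mul_right ?_ (Real.exp_pos (2 * L))
    rw [this]
    linarith

/-- norm bound after preconditioning and subsampling:
`w` keeps the entries of `y = H D x` on a uniformly random `m`-element subset of the
coordinates (independent of `D`) and zeroes the rest; then with probability `≥ 1 − α`,
`‖w‖₂² ≤ (m/p)·(2/η)·log(2p/α)·‖x‖₂²`. -/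
theorem stmt_3 (p m : ℕ) (hp : 0 < p) (hm : m ≤ p)
    (x : Fin p → ℝ) (η : ℝ) (hη : 0 < η)
    (H : Matrix (Fin p) (Fin p) ℝ)
    (hH : ∀ j l, |H j l| ≤ 1 / Real.sqrt (η * p))
    (α : ℝ) (hα0 : 0 < α) (hα1 : α < 1) :
    probOf {ω : (Fin p → Bool) × {S : Finset (Fin p) // S.card = m} |
        ∑ j, (if j ∈ ω.2.1 then ((H * signMatrix ω.1) *ᵥ x) j else 0) ^ 2 ≤
          ((m : ℝ) / p) * (2 / η) * Real.log (2 * p / α) * ∑ j, x j ^ 2} ≥ 1 - α := by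
  classical
  set X := ∑ j, x j ^ 2 with hX
  set L := Real.log (2 * p / α) with hLdef
  have hpR : (1 : ℝ) ≤ p := by exact_mod_cast hp
  have hp0 : (0 : ℝ) < p := by linarith
  have hL : 0 ≤ L := Real.log_nonneg (by rw [le_div_iff₀ hα0]; linarith)
  have hX0 : 0 ≤ X := Finset.sum_nonneg fun i _ => sq_nonneg _
  have hexpL : Real.exp (-L) = α / (2 * p) := by
    rw [Real.exp_neg, hLdef, Real.exp_log (by positivity), inv_div]
  set v := X / (η * p) with hv
  set B : Fin p → Finset (Fin p → Bool) := fun j => Finset.univ.filter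
      (fun ω => 2 * v * L < (∑ i, (H j i * x i) * signVec ω i) ^ 2) with hBdef
  have hBj : ∀ j, ((B j).card : ℝ) ≤ 2 ^ p * (α / p) := by
    intro j
    have h := tail_aux (fun i => H j i * x i) v L hL (by
      rw [hv, hX, Finset.sum_div]
      apply Finset.sum_le_sum
      intro i _
      have h1 : H j i ^ 2 ≤ 1 / (η * p) := by
        have h2 := pow_le_pow_left₀ (abs_nonneg _) (hH j i) 2
        rwa [sq_abs, div_pow, Real.sq_sqrt (by positivity), one_pow] at h2
      calc (H j i * x i) ^ 2 = H j i ^ 2 * x i ^ 2 := by ring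
        _ ≤ 1 / (η * p) * x i ^ 2 := by gcongr
        _ = _ := by ring)
    rw [hexpL] at h
    calc ((B j).card : ℝ) ≤ _ := h
      _ = _ := by field_simp
  set U := Finset.univ.biUnion B with hU
  have hUcard : (U.card : ℝ) ≤ 2 ^ p * α := by
    calc (U.card : ℝ) ≤ ((∑ j, (B j).card : ℕ) : ℝ) := by exact_mod_cast Finset.card_biUnion_le
      _ = ∑ j, ((B j).card : ℝ) := by push_cast; rfl
      _ ≤ ∑ _j : Fin p, 2 ^ p * (α / p) := Finset.sum_le_sum fun j _ => hBj j
      _ = _ := by simp; field_simp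
  set N := Fintype.card {S : Finset (Fin p) // S.card = m} with hN
  have hNpos : 0 < N := by
    obtain ⟨S, -, hS⟩ := Finset.exists_subset_card_eq (s := (Finset.univ : Finset (Fin p)))
      (n := m) (by simpa using hm)
    exact Fintype.card_pos_iff.2 ⟨⟨S, hS⟩⟩
  have hNR : (0 : ℝ) < N := by exact_mod_cast hNpos
  unfold probOf
  rw [ge_iff_le, Fintype.card_prod, ← hN]
  have hc : Fintype.card (Fin p → Bool) = 2 ^ p := by simp
  rw [hc]
  push_cast
  rw [le_div_iff₀ (by positivity)]
  have hsub : ((Uᶜ ×ˢ Finset.univ : Finset ((Fin p → Bool) ×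
      {S : Finset (Fin p) // S.card = m})) : Set _) ⊆
      {ω : (Fin p → Bool) × {S : Finset (Fin p) // S.card = m} |
        ∑ j, (if j ∈ ω.2.1 then ((H * signMatrix ω.1) *ᵥ x) j else 0) ^ 2 ≤
          ((m : ℝ) / p) * (2 / η) * L * X} := by
    rintro ⟨ω, S, hS⟩ h
    have h1 : ∀ j, (∑ i, (H j i * x i) * signVec ω i) ^ 2 ≤ 2 * v * L := by
      simpa [hU, hBdef] using h
    have hy : ∀ j, ((H * signMatrix ω) *ᵥ x) j = ∑ i, (H j i * x i) * signVec ω i := by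
      intro j
      simp only [signMatrix, Matrix.mulVec, dotProduct, Matrix.mul_diagonal]
      exact Finset.sum_congr rfl fun i _ => by ring
    simp only [Set.mem_ofPred_eq, hy]
    calc ∑ j, (if j ∈ S then ∑ i, (H j i * x i) * signVec ω i else 0) ^ 2
        = ∑ j ∈ S, (∑ i, (H j i * x i) * signVec ω i) ^ 2 := by
          simp [ite_pow, Finset.sum_ite_mem]
      _ ≤ ∑ _j ∈ S, 2 * v * L := Finset.sum_le_sum fun j _ => h1 j
      _ = _ := by
          rw [Finset.sum_const, hS, nsmul_eq_mul, hv]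
          field_simp
  have hle := Set.ncard_le_ncard hsub (Set.toFinite _)
  rw [Set.ncard_coe_finset, Finset.card_product, Finset.card_univ, ← hN] at hle
  have hcompl : ((Uᶜ.card : ℕ) : ℝ) = 2 ^ p - U.card := by
    have := Finset.card_add_card_compl U
    rw [hc] at this
    have h2 : (U.card : ℝ) + (Uᶜ.card : ℝ) = 2 ^ p := by exact_mod_cast this
    linarith
  have hleR := (Nat.cast_le (α := ℝ)).2 hle
  rw [Nat.cast_mul] at hleR
  refine le_trans ?_ hleR
  rw [hcompl, ← mul_assoc]
  apply mul_le_mul_of_nonneg_right _ hNR.le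
  linarith
end

section
/- Let X = [x₁,…,x_n] ∈ ℝ^{p×n}, let 1 ≤ m ≤ p, and let R₁,…,R_n ∈ ℝ^{p×m} be independent sampling matrices (each consisting of m distinct canonical basis vectors of ℝ^p chosen uniformly at random without replacement). Define x̂̄_n = (p/m)·(1/n)·Σ_{i=1}^n R_i R_iᵀ x_i and x̄_n = (1/n)·Σ_{i=1}^n x_i, and let τ(m,p) = max{ p/m − 1, 1 }. Then for all t ≥ 0, P( ‖x̂̄_n − x̄_n‖_∞ ≤ t ) ≥ 1 − δ₁, where δ₁ = 2p·exp( −(n t²/2) / ( (p/m − 1)·‖X‖²_max-row/n + τ(m,p)·‖X‖_max·t/3 ) ). -/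
open Matrix Finset

lemma exp_quad_bound (y b : ℝ) (hb : b < 3) (hy : |y| ≤ b) :
    Real.exp y ≤ 1 + y + y ^ 2 / (2 * (1 - b / 3)) := by
  have hb0 : 0 ≤ b := (abs_nonneg y).trans hy
  have h1 : HasSum (fun k : ℕ => y ^ k / (k.factorial : ℝ)) (Real.exp y) := by
    rw [Real.exp_eq_exp_ℝ]
    exact NormedSpace.expSeries_div_hasSum_exp y
  have h2 := (hasSum_nat_add_iff' 2).mpr h1
  have h3 : HasSum (fun k : ℕ => y ^ 2 / 2 * (b / 3) ^ k) (y ^ 2 / 2 * (1 - b / 3)⁻¹) :=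
    (hasSum_geometric_of_lt_one (by positivity) (by linarith)).mul_left _
  have h4 := hasSum_le (fun k => ?_) h2 h3
  · have e : y ^ 2 / (2 * (1 - b / 3)) = y ^ 2 / 2 * (1 - b / 3)⁻¹ := by
      rw [div_mul_eq_div_div, div_eq_mul_inv _ (1 - b / 3)]
    simp [Finset.sum_range_succ] at h4
    rw [e]
    simp
    linarith
  · have hf : (2 : ℝ) * 3 ^ k ≤ ((k + 2).factorial : ℝ) := by
      have := @Nat.factorial_mul_pow_le_factorial 2 k
      norm_num at this
      rw [add_comm k 2]
      exact_mod_cast this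
    calc y ^ (k + 2) / ((k + 2).factorial : ℝ) ≤ |y| ^ (k + 2) / ((k + 2).factorial : ℝ) := by
          apply div_le_div_of_nonneg_right _ (by positivity)
          rw [← abs_pow]
          exact le_abs_self _
      _ ≤ |y| ^ (k + 2) / (2 * 3 ^ k) := by gcongr
      _ = y ^ 2 / 2 * (|y| / 3) ^ k := by
          rw [pow_add, sq_abs, div_pow]; field_simp
      _ ≤ y ^ 2 / 2 * (b / 3) ^ k := by gcongr

lemma tailBound_pos {S : Type*} [Fintype S] [Nonempty S] {n : ℕ} (f : Fin n → S → ℝ)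
    (L V s : ℝ) (hL : ∀ i σ, |f i σ| ≤ L) (hL0 : 0 ≤ L) (hmean : ∀ i, ∑ σ, f i σ = 0)
    (hvar : ∑ i, ∑ σ, (f i σ) ^ 2 ≤ V * Fintype.card S) (hV : 0 < V) (hs : 0 < s) :
    (({ω : Fin n → S | s < ∑ i, f i (ω i)} : Set (Fin n → S)).ncard : ℝ) ≤
      Real.exp (-(s ^ 2 / 2) / (V + L * s / 3)) * Fintype.card (Fin n → S) := by
  classical
  set W := V + L * s / 3 with hW
  have hWpos : 0 < W := by positivity
  set l := s / W with hl
  have hlpos : 0 < l := by positivity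
  have hlL : 1 - l * L / 3 = V / W := by
    rw [hl]; field_simp; rw [hW]; ring
  have hVW : 0 < V / W := by positivity
  set c := l ^ 2 / (2 * (1 - l * L / 3)) with hc
  have hcv : c * V = s ^ 2 / 2 / W := by
    rw [hc, hlL, hl]; field_simp
  set N : ℝ := (Fintype.card S : ℝ) with hN
  have hNpos : 0 < N := by rw [hN]; exact_mod_cast Fintype.card_pos
  have hone : ∀ i, ∑ σ, Real.exp (l * f i σ) ≤ N * Real.exp (c * (∑ σ, (f i σ) ^ 2) / N) := by
    intro i
    calc ∑ σ, Real.exp (l * f i σ) ≤ ∑ σ, (1 + l * f i σ + c * (f i σ) ^ 2) := by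
          apply Finset.sum_le_sum
          intro σ _
          have := exp_quad_bound (l * f i σ) (l * L) (by linarith)
            (by rw [abs_mul, abs_of_pos hlpos]; exact mul_le_mul_of_nonneg_left (hL i σ) hlpos.le)
          refine this.trans (le_of_eq ?_)
          rw [hc]; ring
      _ = N * (c * (∑ σ, (f i σ) ^ 2) / N + 1) := by
          rw [Finset.sum_add_distrib, Finset.sum_add_distrib, ← Finset.mul_sum, hmean,
            ← Finset.mul_sum]
          simp only [Finset.sum_const, Finset.card_univ, nsmul_eq_mul, ← hN]
          field_simp
          ring
      _ ≤ _ := by gcongr; exact Real.add_one_le_exp _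
  have hcard : (Fintype.card (Fin n → S) : ℝ) = N ^ n := by
    rw [hN]; simp
  rw [hcard]
  calc (({ω : Fin n → S | s < ∑ i, f i (ω i)} : Set (Fin n → S)).ncard : ℝ)
      = ∑ ω : Fin n → S, if s < ∑ i, f i (ω i) then (1 : ℝ) else 0 := by
        rw [Set.ncard_eq_toFinset_card']
        simp
    _ ≤ ∑ ω : Fin n → S, Real.exp (-(l * s)) * ∏ i, Real.exp (l * f i (ω i)) := by
        apply Finset.sum_le_sum
        intro ω _
        rw [← Real.exp_sum, ← Real.exp_add, ← Finset.mul_sum]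
        split_ifs with h
        · apply Real.one_le_exp
          nlinarith
        · positivity
    _ = Real.exp (-(l * s)) * ∏ i, ∑ σ, Real.exp (l * f i σ) := by
        rw [← Finset.mul_sum, Finset.prod_univ_sum]
        simp
    _ ≤ Real.exp (-(l * s)) * ∏ i, (N * Real.exp (c * (∑ σ, (f i σ) ^ 2) / N)) := by
        gcongr with i
        exact hone i
    _ = Real.exp (-(l * s)) * Real.exp (c * (∑ i, ∑ σ, (f i σ) ^ 2) / N) * N ^ n := by
        rw [Finset.prod_mul_distrib, ← Real.exp_sum, ← Finset.sum_div, ← Finset.mul_sum]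
        simp
        ring
    _ ≤ _ := by
        gcongr
        rw [← Real.exp_add]
        apply Real.exp_le_exp.mpr
        have hc0 : 0 ≤ c := by rw [hc, hlL]; positivity
        have h1 : c * (∑ i, ∑ σ, (f i σ) ^ 2) / N ≤ c * V := by
          rw [div_le_iff₀ hNpos, mul_assoc]
          exact mul_le_mul_of_nonneg_left hvar hc0
        have h2 : l * s = s ^ 2 / W := by rw [hl]; ring
        rw [hcv] at h1
        rw [h2]
        have : -(s ^ 2 / 2) / W = -(s ^ 2 / W) + s ^ 2 / 2 / W := by ring
        linarith

lemma tailBound_nonneg {S : Type*} [Fintype S] [Nonempty S] {n : ℕ} (f : Fin n → S → ℝ)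
    (L V s : ℝ) (hL : ∀ i σ, |f i σ| ≤ L) (hL0 : 0 ≤ L) (hmean : ∀ i, ∑ σ, f i σ = 0)
    (hvar : ∑ i, ∑ σ, (f i σ) ^ 2 ≤ V * Fintype.card S) (hV : 0 ≤ V) (hs : 0 < s)
    (hD : 0 < V + L * s / 3) :
    (({ω : Fin n → S | s < ∑ i, f i (ω i)} : Set (Fin n → S)).ncard : ℝ) ≤
      Real.exp (-(s ^ 2 / 2) / (V + L * s / 3)) * Fintype.card (Fin n → S) := by
  have hcont : ContinuousAt (fun v : ℝ => Real.exp (-(s ^ 2 / 2) / (v + L * s / 3)) *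
      (Fintype.card (Fin n → S) : ℝ)) V := by
    apply ContinuousAt.mul _ continuousAt_const
    apply Real.continuous_exp.continuousAt.comp
    exact ContinuousAt.div continuousAt_const (by fun_prop) hD.ne'
  have ht := hcont.tendsto.mono_left (nhdsWithin_le_nhds (s := Set.Ioi V))
  refine ge_of_tendsto ht ?_
  filter_upwards [self_mem_nhdsWithin] with v hv
  have hv' : V < v := hv
  refine tailBound_pos f L v s hL hL0 hmean (hvar.trans ?_) (by linarith) hs
  gcongr

lemma tailBound_two {S : Type*} [Fintype S] [Nonempty S] {n : ℕ} (f : Fin n → S → ℝ)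
    (L V s : ℝ) (hL : ∀ i σ, |f i σ| ≤ L) (hL0 : 0 ≤ L) (hmean : ∀ i, ∑ σ, f i σ = 0)
    (hvar : ∑ i, ∑ σ, (f i σ) ^ 2 ≤ V * Fintype.card S) (hV : 0 ≤ V) (hs : 0 < s)
    (hD : 0 < V + L * s / 3) :
    (({ω : Fin n → S | s < |∑ i, f i (ω i)|} : Set (Fin n → S)).ncard : ℝ) ≤
      2 * Real.exp (-(s ^ 2 / 2) / (V + L * s / 3)) * Fintype.card (Fin n → S) := by
  have h1 := tailBound_nonneg f L V s hL hL0 hmean hvar hV hs hD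
  have h2 := tailBound_nonneg (fun i σ => - f i σ) L V s (by simpa using hL) hL0
    (by simpa using hmean) (by simpa using hvar) hV hs hD
  have hsub : {ω : Fin n → S | s < |∑ i, f i (ω i)|} ⊆
      {ω : Fin n → S | s < ∑ i, f i (ω i)} ∪ {ω : Fin n → S | s < ∑ i, - f i (ω i)} := by
    intro ω hω
    simp only [Set.mem_ofPred_eq, lt_abs, Set.mem_union, Finset.sum_neg_distrib] at *
    exact hω
  have h3 : (({ω : Fin n → S | s < |∑ i, f i (ω i)|} : Set (Fin n → S)).ncard : ℝ) ≤
      (({ω : Fin n → S | s < ∑ i, f i (ω i)} : Set (Fin n → S)).ncard : ℝ) +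
      (({ω : Fin n → S | s < ∑ i, - f i (ω i)} : Set (Fin n → S)).ncard : ℝ) := by
    exact_mod_cast (Set.ncard_le_ncard hsub (Set.toFinite _)).trans (Set.ncard_union_le _ _)
  linarith

/-- indicator that coordinate `j` is sampled -/
noncomputable def qInd {p m : ℕ} (σ : Fin m ↪ Fin p) (j : Fin p) : ℝ :=
  ∑ k, if σ k = j then (1 : ℝ) else 0

lemma qInd_cases {p m : ℕ} (σ : Fin m ↪ Fin p) (j : Fin p) : qInd σ j = 0 ∨ qInd σ j = 1 := by
  unfold qInd
  by_cases h : ∃ k, σ k = j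
  · obtain ⟨k, rfl⟩ := h
    right
    simp [σ.injective.eq_iff]
  · push Not at h
    left
    simp [h]

lemma samp_mulVec {p m : ℕ} (σ : Fin m ↪ Fin p) (v : Fin p → ℝ) (j : Fin p) :
    ((sampMatrix σ * (sampMatrix σ)ᵀ) *ᵥ v) j = qInd σ j * v j := by
  rw [← Matrix.mulVec_mulVec]
  simp only [Matrix.mulVec, dotProduct, sampMatrix, Matrix.of_apply, Matrix.transpose_apply, qInd,
    Finset.sum_mul]
  apply Finset.sum_congr rfl
  intro k _
  by_cases h : σ k = j <;> simp [h]

lemma sum_qInd {p m : ℕ} (j : Fin p) :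
    (p : ℝ) * ∑ σ : Fin m ↪ Fin p, qInd σ j = m * Fintype.card (Fin m ↪ Fin p) := by
  have hsym : ∀ j', ∑ σ : Fin m ↪ Fin p, qInd σ j' = ∑ σ : Fin m ↪ Fin p, qInd σ j := by
    intro j'
    refine Fintype.sum_equiv (Equiv.embeddingCongr (Equiv.refl _) (Equiv.swap j' j)) _ _ ?_
    intro σ
    unfold qInd
    apply Finset.sum_congr rfl
    intro k _
    have : ((Equiv.embeddingCongr (Equiv.refl _) (Equiv.swap j' j)) σ) k
        = Equiv.swap j' j (σ k) := by
      simp [Equiv.embeddingCongr_apply]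
    simp only [this, Equiv.swap_apply_eq_iff, Equiv.swap_apply_right]
  have h2 : ∑ j', ∑ σ : Fin m ↪ Fin p, qInd σ j' = m * Fintype.card (Fin m ↪ Fin p) := by
    rw [Finset.sum_comm]
    have : ∀ σ : Fin m ↪ Fin p, ∑ j', qInd σ j' = m := by
      intro σ
      unfold qInd
      rw [Finset.sum_comm]
      simp
    simp [this, mul_comm]
  rw [← h2, Finset.sum_congr rfl (fun j' _ => hsym j')]
  simp

/-- ℓ∞ concentration of the sample mean estimator:
with `x̂̄_n = (p/m)(1/n) Σᵢ Rᵢ Rᵢᵀ xᵢ`, `x̄_n = (1/n) Σᵢ xᵢ`,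
`τ(m,p) = max{p/m − 1, 1}`, `‖X‖_max = max_{j,i} |X_{j,i}|` and
`‖X‖²_max-row = max_j Σᵢ X_{j,i}²` (`X` has the `xᵢ` as columns),
`P(‖x̂̄_n − x̄_n‖_∞ ≤ t) ≥ 1 − δ₁` where
`δ₁ = 2p·exp(−(n t²/2)/((p/m−1)‖X‖²_max-row/n + τ(m,p)‖X‖_max t/3))`. -/
theorem stmt_6 (p n m : ℕ) (hp : 0 < p) (hn : 0 < n) (hm : 1 ≤ m) (hmp : m ≤ p)
    (x : Fin n → Fin p → ℝ) (t : ℝ) (ht : 0 ≤ t) :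
    probOf {ω : Fin n → (Fin m ↪ Fin p) |
        (⨆ j, |(((p : ℝ) / m) • ((n : ℝ)⁻¹ •
            ∑ i, (sampMatrix (ω i) * (sampMatrix (ω i))ᵀ) *ᵥ x i)) j -
          ((n : ℝ)⁻¹ • ∑ i, x i) j|) ≤ t} ≥
      1 - 2 * p * Real.exp (-(n * t ^ 2 / 2) /
        (((p : ℝ) / m - 1) * (⨆ j, ∑ i, x i j ^ 2) / n +
          max ((p : ℝ) / m - 1) 1 * (⨆ j, ⨆ i, |x i j|) * t / 3)) := by
  classical
  have : Nonempty (Fin p) := ⟨⟨0, hp⟩⟩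
  have : Nonempty (Fin n) := ⟨⟨0, hn⟩⟩
  have : Nonempty (Fin m ↪ Fin p) := ⟨Fin.castLEEmb hmp⟩
  have hpR : (1 : ℝ) ≤ p := by exact_mod_cast hp
  have hnR : (0 : ℝ) < n := by exact_mod_cast hn
  have hmR : (0 : ℝ) < m := by exact_mod_cast hm
  have hpm : (1 : ℝ) ≤ (p : ℝ) / m := by
    rw [le_div_iff₀ hmR]; simpa using (by exact_mod_cast hmp : (m : ℝ) ≤ p)
  set r : ℝ := (p : ℝ) / m with hr
  set A : ℝ := ⨆ j, ∑ i, x i j ^ 2 with hA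
  set B : ℝ := ⨆ j, ⨆ i, |x i j| with hB
  have hAj : ∀ j, ∑ i, x i j ^ 2 ≤ A := fun j =>
    le_ciSup (f := fun j => ∑ i, x i j ^ 2) (Set.finite_range _).bddAbove j
  have hBj : ∀ i j, |x i j| ≤ B := fun i j =>
    (le_ciSup (f := fun i => |x i j|) (Set.finite_range _).bddAbove i).trans
      (le_ciSup (f := fun j => ⨆ i, |x i j|) (Set.finite_range _).bddAbove j)
  have hA0 : 0 ≤ A := (Finset.sum_nonneg fun i _ => sq_nonneg _).trans (hAj ⟨0, hp⟩)
  have hB0 : 0 ≤ B := (abs_nonneg _).trans (hBj ⟨0, hn⟩ ⟨0, hp⟩)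
  have hr0 : 0 ≤ r - 1 := by linarith
  have hmax : (0 : ℝ) ≤ max (r - 1) 1 := le_max_of_le_right zero_le_one
  set D : ℝ := (r - 1) * A / n + max (r - 1) 1 * B * t / 3 with hD
  have hD0 : 0 ≤ D := by positivity
  have hcardpos : (0 : ℝ) < Fintype.card (Fin n → (Fin m ↪ Fin p)) := by
    exact_mod_cast Fintype.card_pos
  by_cases htriv : D = 0 ∨ t = 0
  · have he : -(n * t ^ 2 / 2) / D = 0 := by
      rcases htriv with h | h <;> simp [h]
    rw [he, Real.exp_zero]
    have : (0 : ℝ) ≤ probOf {ω : Fin n → (Fin m ↪ Fin p) |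
        (⨆ j, |(r • ((n : ℝ)⁻¹ •
            ∑ i, (sampMatrix (ω i) * (sampMatrix (ω i))ᵀ) *ᵥ x i)) j -
          ((n : ℝ)⁻¹ • ∑ i, x i) j|) ≤ t} := by
      unfold probOf; positivity
    linarith
  push Not at htriv
  obtain ⟨hDne, htne⟩ := htriv
  have hDpos : 0 < D := lt_of_le_of_ne hD0 (Ne.symm hDne)
  have htpos : 0 < t := lt_of_le_of_ne ht (Ne.symm htne)
  have hDe : (r - 1) * A + max (r - 1) 1 * B * (n * t) / 3 = n * D := by
    rw [hD]; field_simp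
  have key : ∀ j : Fin p, (({ω : Fin n → (Fin m ↪ Fin p) | (n * t : ℝ) <
      |∑ i, (r * qInd (ω i) j - 1) * x i j|} : Set _).ncard : ℝ) ≤
      2 * Real.exp (-(n * t ^ 2 / 2) / D) * Fintype.card (Fin n → (Fin m ↪ Fin p)) := by
    intro j
    have hq := sum_qInd (m := m) j
    have hq' : r * ∑ σ : Fin m ↪ Fin p, qInd σ j = Fintype.card (Fin m ↪ Fin p) := by
      rw [hr, div_mul_eq_mul_div, hq]; field_simp
    have hmean : ∑ σ : Fin m ↪ Fin p, (r * qInd σ j - 1) = 0 := by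
      rw [Finset.sum_sub_distrib, ← Finset.mul_sum, hq']; simp
    have hvar : ∑ σ : Fin m ↪ Fin p, (r * qInd σ j - 1) ^ 2
        = (r - 1) * Fintype.card (Fin m ↪ Fin p) := by
      have : ∀ σ : Fin m ↪ Fin p, (r * qInd σ j - 1) ^ 2
          = (r - 1) * (r * qInd σ j) - (r * qInd σ j - 1) := by
        intro σ
        rcases qInd_cases σ j with h | h <;> rw [h] <;> ring
      rw [Finset.sum_congr rfl (fun σ _ => this σ), Finset.sum_sub_distrib, hmean,
        ← Finset.mul_sum, ← Finset.mul_sum, hq', sub_zero]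
    have := tailBound_two (fun (i : Fin n) (σ : Fin m ↪ Fin p) => (r * qInd σ j - 1) * x i j)
      (max (r - 1) 1 * B) ((r - 1) * A) (n * t) ?_ (by positivity) ?_ ?_ (by positivity)
      (by positivity) (by rw [hDe]; positivity)
    · rw [hDe] at this
      have e : -((n * t) ^ 2 / 2) / (n * D) = -(n * t ^ 2 / 2) / D := by
        field_simp
      rw [e] at this
      exact this
    · intro i σ
      rw [abs_mul]
      refine mul_le_mul ?_ (hBj i j) (abs_nonneg _) hmax
      rcases qInd_cases σ j with h | h <;> rw [h]
      · simp
      · rw [mul_one, abs_of_nonneg hr0]; exact le_max_left _ _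
    · intro i
      rw [← Finset.sum_mul, hmean, zero_mul]
    · simp only [mul_pow, ← Finset.sum_mul, hvar]
      rw [← Finset.mul_sum]
      have := mul_le_mul_of_nonneg_left (hAj j)
        (mul_nonneg hr0 (Nat.cast_nonneg (α := ℝ) (Fintype.card (Fin m ↪ Fin p))))
      linarith
  set G : Set (Fin n → (Fin m ↪ Fin p)) := {ω | (⨆ j, |(r • ((n : ℝ)⁻¹ •
            ∑ i, (sampMatrix (ω i) * (sampMatrix (ω i))ᵀ) *ᵥ x i)) j -
          ((n : ℝ)⁻¹ • ∑ i, x i) j|) ≤ t} with hG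
  have hcompl : Gᶜ ⊆ ⋃ j ∈ (Finset.univ : Finset (Fin p)), {ω : Fin n → (Fin m ↪ Fin p) |
      (n * t : ℝ) < |∑ i, (r * qInd (ω i) j - 1) * x i j|} := by
    intro ω hω
    by_contra hcon
    apply hω
    simp only [Set.mem_iUnion, Set.mem_ofPred_eq, Finset.mem_univ, not_exists, not_lt,
      forall_true_left] at hcon
    rw [hG, Set.mem_ofPred_eq]
    refine ciSup_le fun j => ?_
    have e : (r • ((n : ℝ)⁻¹ •
            ∑ i, (sampMatrix (ω i) * (sampMatrix (ω i))ᵀ) *ᵥ x i)) j -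
          ((n : ℝ)⁻¹ • ∑ i, x i) j = (n : ℝ)⁻¹ * ∑ i, (r * qInd (ω i) j - 1) * x i j := by
      simp only [Pi.smul_apply, Finset.sum_apply, smul_eq_mul, samp_mulVec, sub_mul, one_mul,
        Finset.sum_sub_distrib, mul_assoc, ← Finset.mul_sum]
      ring
    rw [e, abs_mul, abs_of_pos (inv_pos.mpr hnR), inv_mul_le_iff₀ hnR]
    exact hcon j
  have hcb : ((Gᶜ).ncard : ℝ) ≤
      p * (2 * Real.exp (-(n * t ^ 2 / 2) / D) * Fintype.card (Fin n → (Fin m ↪ Fin p))) := by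
    have h1 := (Set.ncard_le_ncard hcompl (Set.toFinite _)).trans
      (Finset.set_ncard_biUnion_le _ _)
    calc ((Gᶜ).ncard : ℝ) ≤ ∑ j : Fin p, (({ω : Fin n → (Fin m ↪ Fin p) |
      (n * t : ℝ) < |∑ i, (r * qInd (ω i) j - 1) * x i j|} : Set _).ncard : ℝ) := by
          exact_mod_cast h1
      _ ≤ ∑ j : Fin p, (2 * Real.exp (-(n * t ^ 2 / 2) / D) *
            Fintype.card (Fin n → (Fin m ↪ Fin p))) := Finset.sum_le_sum fun j _ => key j
      _ = _ := by simp
  have hadd : (G.ncard : ℝ) + ((Gᶜ).ncard : ℝ) = Fintype.card (Fin n → (Fin m ↪ Fin p)) := by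
    have := Set.ncard_add_ncard_compl G (Set.toFinite _) (Set.toFinite _)
    rw [Nat.card_eq_fintype_card] at this
    exact_mod_cast this
  unfold probOf
  rw [ge_iff_le, le_div_iff₀ hcardpos]
  linarith
end

section
/- Let x₁,…,x_n ∈ ℝ^p, let 2 ≤ m ≤ p, and let R₁,…,R_n ∈ ℝ^{p×m} be independent sampling matrices (each consisting of m distinct canonical basis vectors of ℝ^p chosen uniformly at random without replacement). Define Ĉ_emp = (p(p−1)/(m(m−1)))·(1/n)·Σ_{i=1}^n R_i R_iᵀ x_i x_iᵀ R_i R_iᵀ and Ĉ_n = Ĉ_emp − ((p−m)/(p−1))·diag(Ĉ_emp). Then Ĉ_n is an unbiased estimator of the empirical covariance matrix C_emp = (1/n)·Σ_{i=1}^n x_i x_iᵀ, i.e., E[Ĉ_n] = C_emp. -/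
open Matrix Finset

/-- The rescaled empirical covariance of the subsampled data,
`Ĉ_emp = (p(p−1)/(m(m−1)))·(1/n)·Σᵢ Rᵢ Rᵢᵀ xᵢ xᵢᵀ Rᵢ Rᵢᵀ`. -/
noncomputable def covHat {p n m : ℕ} (x : Fin n → Fin p → ℝ)
    (ω : Fin n → (Fin m ↪ Fin p)) : Matrix (Fin p) (Fin p) ℝ :=
  (((p : ℝ) * ((p : ℝ) - 1)) / ((m : ℝ) * ((m : ℝ) - 1))) •
    ((n : ℝ)⁻¹ • ∑ i,
      (sampMatrix (ω i) * (sampMatrix (ω i))ᵀ) * Matrix.vecMulVec (x i) (x i) *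
        (sampMatrix (ω i) * (sampMatrix (ω i))ᵀ))

/-- The debiased covariance estimator `Ĉ_n = Ĉ_emp − ((p−m)/(p−1))·diag(Ĉ_emp)`. -/
noncomputable def covEst {p n m : ℕ} (x : Fin n → Fin p → ℝ)
    (ω : Fin n → (Fin m ↪ Fin p)) : Matrix (Fin p) (Fin p) ℝ :=
  covHat x ω - ((((p : ℝ) - m)) / ((p : ℝ) - 1)) • diagPart (covHat x ω)

/-- Indicator that coordinate `a` is sampled. -/
noncomputable def sInd {p m : ℕ} (σ : Fin m ↪ Fin p) (a : Fin p) : ℝ :=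
  ∑ j, if σ j = a then 1 else 0

lemma sInd_sq {p m : ℕ} (σ : Fin m ↪ Fin p) (a : Fin p) : sInd σ a * sInd σ a = sInd σ a := by
  unfold sInd
  by_cases h : ∃ j, σ j = a
  · obtain ⟨j, rfl⟩ := h
    simp
  · push Not at h
    simp [h]

lemma sInd_sum {p m : ℕ} (σ : Fin m ↪ Fin p) : ∑ a, sInd σ a = m := by
  unfold sInd
  rw [Finset.sum_comm]
  simp

lemma samp_mul {p m : ℕ} (σ : Fin m ↪ Fin p) :
    sampMatrix σ * (sampMatrix σ)ᵀ = Matrix.diagonal (sInd σ) := by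
  ext a b
  simp only [sampMatrix, Matrix.mul_apply, Matrix.transpose_apply, Matrix.of_apply,
    Matrix.diagonal_apply, sInd]
  split_ifs with h
  · subst h
    exact Finset.sum_congr rfl fun j _ => by simp
  · refine Finset.sum_eq_zero fun j _ => ?_
    by_cases h1 : σ j = a
    · simp [h1, h]
    · simp [h1]

/-- Total of the joint inclusion indicators. -/
noncomputable def sF {p n m : ℕ} (i : Fin n) (a b : Fin p) : ℝ :=
  ∑ ω : Fin n → (Fin m ↪ Fin p), sInd (ω i) a * sInd (ω i) b

lemma sF_perm {p n m : ℕ} (i : Fin n) (π : Equiv.Perm (Fin p)) (a b : Fin p) :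
    sF (m := m) i (π a) (π b) = sF (m := m) i a b := by
  unfold sF
  symm
  refine Fintype.sum_equiv
    (Equiv.arrowCongr (Equiv.refl (Fin n)) (Equiv.embeddingCongr (Equiv.refl (Fin m)) π)) _ _ ?_
  intro ω
  simp [sInd]

lemma sF_row {p n m : ℕ} (i : Fin n) (a : Fin p) :
    ∑ b, sF (m := m) i a b = m * sF (m := m) i a a := by
  unfold sF
  rw [Finset.sum_comm, Finset.mul_sum]
  refine Finset.sum_congr rfl fun ω _ => ?_
  rw [← Finset.mul_sum, sInd_sum, sInd_sq, mul_comm]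

lemma sF_diag {p n m : ℕ} (i : Fin n) (a : Fin p) :
    p * sF (m := m) i a a = m * Fintype.card (Fin n → (Fin m ↪ Fin p)) := by
  have h1 : ∑ c : Fin p, sF (m := m) i c c = m * Fintype.card (Fin n → (Fin m ↪ Fin p)) := by
    unfold sF
    rw [Finset.sum_comm]
    simp only [sInd_sq, sInd_sum]
    rw [Finset.sum_const, Finset.card_univ, nsmul_eq_mul, mul_comm]
  rw [← h1, Finset.sum_congr rfl (g := fun _ => sF (m := m) i a a)]
  · simp
  · intro c _
    have := sF_perm (m := m) i (Equiv.swap a c) a a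
    simpa using this

lemma sF_off {p n m : ℕ} (i : Fin n) (a b : Fin p) (hab : a ≠ b) :
    ((p : ℝ) - 1) * sF (m := m) i a b = ((m : ℝ) - 1) * sF (m := m) i a a := by
  have h1 := sF_row (m := m) i a
  rw [← Finset.add_sum_erase _ _ (Finset.mem_univ a),
    Finset.sum_congr rfl (g := fun _ => sF (m := m) i a b)] at h1
  · rw [Finset.sum_const, Finset.card_erase_of_mem (Finset.mem_univ a), Finset.card_univ,
      Fintype.card_fin, nsmul_eq_mul, Nat.cast_sub (by have := a.2; omega)] at h1
    push_cast at h1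
    linarith
  · intro c hc
    have hca : c ≠ a := Finset.ne_of_mem_erase hc
    have := sF_perm (m := m) i (Equiv.swap b c) a b
    rw [Equiv.swap_apply_of_ne_of_ne hab hca.symm, Equiv.swap_apply_left] at this
    exact this

lemma covHat_apply {p n m : ℕ} (x : Fin n → Fin p → ℝ)
    (ω : Fin n → (Fin m ↪ Fin p)) (a b : Fin p) :
    covHat x ω a b = (((p : ℝ) * ((p : ℝ) - 1)) / ((m : ℝ) * ((m : ℝ) - 1))) *
      ((n : ℝ)⁻¹ * ∑ i, (x i a * x i b) * (sInd (ω i) a * sInd (ω i) b)) := by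
  simp only [covHat, samp_mul, Matrix.smul_apply, Matrix.sum_apply, smul_eq_mul,
    Matrix.mul_diagonal, Matrix.diagonal_mul, Matrix.vecMulVec_apply]
  congr 2
  exact Finset.sum_congr rfl fun i _ => by ring

lemma covHat_sum {p n m : ℕ} (x : Fin n → Fin p → ℝ) (a b : Fin p) :
    ∑ ω : Fin n → (Fin m ↪ Fin p), covHat x ω a b =
      (((p : ℝ) * ((p : ℝ) - 1)) / ((m : ℝ) * ((m : ℝ) - 1))) *
      ((n : ℝ)⁻¹ * ∑ i, (x i a * x i b) * sF (m := m) i a b) := by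
  simp only [covHat_apply, ← Finset.mul_sum, sF]
  rw [Finset.sum_comm]
  simp only [← Finset.mul_sum]

/-- unbiasedness of the covariance estimator:
`E[Ĉ_n] = C_emp = (1/n)·Σᵢ xᵢ xᵢᵀ`. -/
theorem stmt_7 (p n m : ℕ) (hm : 2 ≤ m) (hmp : m ≤ p)
    (x : Fin n → Fin p → ℝ) :
    expec (fun ω : Fin n → (Fin m ↪ Fin p) => covEst x ω) =
      (n : ℝ)⁻¹ • ∑ i, Matrix.vecMulVec (x i) (x i) := by
  have hne : Nonempty (Fin m ↪ Fin p) := ⟨Fin.castLEEmb hmp⟩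
  have hN : (Fintype.card (Fin n → (Fin m ↪ Fin p)) : ℝ) ≠ 0 :=
    Nat.cast_ne_zero.mpr Fintype.card_ne_zero
  have hm2 : (2 : ℝ) ≤ m := by exact_mod_cast hm
  have hp2 : (2 : ℝ) ≤ p := by exact_mod_cast hm.trans hmp
  have hm0 : (m : ℝ) ≠ 0 := by linarith
  have hm1 : (m : ℝ) - 1 ≠ 0 := by linarith
  have hp0 : (p : ℝ) ≠ 0 := by linarith
  have hp1 : (p : ℝ) - 1 ≠ 0 := by linarith
  ext a b
  simp only [expec, Matrix.smul_apply, Matrix.sum_apply, smul_eq_mul, Matrix.vecMulVec_apply,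
    covEst, Matrix.sub_apply, diagPart, Matrix.diagonal_apply, Matrix.diag_apply]
  have hd : ∀ i : Fin n, sF (m := m) i a a =
      m * Fintype.card (Fin n → (Fin m ↪ Fin p)) / p := fun i => by
    rw [eq_div_iff hp0, ← sF_diag i a, mul_comm]
  generalize (Fintype.card (Fin n → (Fin m ↪ Fin p)) : ℝ) = N at *
  by_cases hab : a = b
  · subst hab
    simp only [if_true, Finset.sum_sub_distrib, ← Finset.mul_sum, covHat_sum, hd,
      ← Finset.sum_mul]
    generalize ∑ i, x i a * x i a = S
    generalize (n : ℝ)⁻¹ = k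
    field_simp
    ring
  · have ho : ∀ i : Fin n, sF (m := m) i a b = (m - 1) * (m * N / p) / (p - 1) := fun i => by
      rw [eq_div_iff hp1, ← hd i, ← sF_off i a b hab, mul_comm]
    simp only [if_neg hab, mul_zero, sub_zero, covHat_sum, ho, ← Finset.sum_mul]
    generalize ∑ i, x i a * x i b = S
    generalize (n : ℝ)⁻¹ = k
    field_simp
end
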